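/- Let τ₀, τ_e, τ_m > 0 and μ₀, x, e ∈ ℝ, and define μ̄(m) := (τ₀·μ₀ + (τ_e + τ_m)·(e − x) − τ_m·(m − x))/(τ₀ + τ_e + τ_m). Let b, c, k₁, σ > 0 with b·σ·√(2π) > k₁, let θ̂(μ) denote the unique solution of b·θ + c + k₁ = k₁·Φ((θ − μ)/σ), and let κ > 0. Then: (i) the function m ↦ Φ(κ·(θ̂(μ̄(m)) − μ̄(m))) is strictly increasing on ℝ; and (ii) for every y ∈ (0, 1) there exists a unique m* ∈ ℝ such that Φ(κ·(θ̂(μ̄(m)) − μ̄(m))) > 1 − y if and only if m > m*. -/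

import Mathlib

open Real MeasureTheory

/-- The standard normal cumulative distribution function
`Φ(z) = (1/√(2π)) ∫_{−∞}^{z} exp(−t²/2) dt`. -/
noncomputable def stdNormalCDF (z : ℝ) : ℝ :=
  (Real.sqrt (2 * Real.pi))⁻¹ * ∫ t in Set.Iic z, Real.exp (-t ^ 2 / 2)

open ProbabilityTheory in
theorem stdNormalCDF_eq_cdf (z : ℝ) : stdNormalCDF z = cdf (gaussianReal 0 1) z := by
  have h := gaussianReal_apply_eq_integral 0 (v := 1) one_ne_zero (Set.Iic z)
  rw [cdf_eq_real, Measure.real, h, ENNReal.toReal_ofReal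
    (integral_nonneg fun t => gaussianPDFReal_nonneg 0 1 t), stdNormalCDF, ← integral_const_mul]
  simp [gaussianPDFReal]

theorem integrable_exp_neg_sq_div_two : Integrable fun t : ℝ => Real.exp (-t ^ 2 / 2) := by
  convert integrable_exp_neg_mul_sq (b := 1 / 2) (by norm_num) using 3
  ring

theorem stdNormalCDF_sub (s t : ℝ) :
    stdNormalCDF t - stdNormalCDF s =
      (Real.sqrt (2 * Real.pi))⁻¹ * ∫ u in s..t, Real.exp (-u ^ 2 / 2) := by
  rw [stdNormalCDF, stdNormalCDF, ← mul_sub, intervalIntegral.integral_Iic_sub_Iic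
    integrable_exp_neg_sq_div_two.integrableOn integrable_exp_neg_sq_div_two.integrableOn]

theorem stdNormalCDF_strictMono : StrictMono stdNormalCDF := by
  intro s t hst
  rw [← sub_pos, stdNormalCDF_sub]
  refine mul_pos (by positivity) ?_
  exact intervalIntegral.intervalIntegral_pos_of_pos
    (integrable_exp_neg_sq_div_two.intervalIntegrable) (fun u => Real.exp_pos _) hst

theorem stdNormalCDF_sub_le {s t : ℝ} (hst : s ≤ t) :
    stdNormalCDF t - stdNormalCDF s ≤ (Real.sqrt (2 * Real.pi))⁻¹ * (t - s) := by
  rw [stdNormalCDF_sub]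
  refine mul_le_mul_of_nonneg_left ?_ (by positivity)
  calc ∫ u in s..t, Real.exp (-u ^ 2 / 2) ≤ ∫ _ in s..t, (1 : ℝ) := by
        refine intervalIntegral.integral_mono_on hst
          integrable_exp_neg_sq_div_two.intervalIntegrable (by simp) fun u _ => ?_
        exact Real.exp_le_one_iff.2 (by nlinarith [sq_nonneg u])
    _ = t - s := by simp

theorem continuous_stdNormalCDF : Continuous stdNormalCDF := by
  have h : stdNormalCDF = fun t => stdNormalCDF 0 +
      (Real.sqrt (2 * Real.pi))⁻¹ * ∫ u in (0 : ℝ)..t, Real.exp (-u ^ 2 / 2) := by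
    ext t
    rw [← stdNormalCDF_sub]
    ring
  rw [h]
  exact continuous_const.add (continuous_const.mul
    (intervalIntegral.continuous_primitive
      (fun _ _ => integrable_exp_neg_sq_div_two.intervalIntegrable) 0))

theorem exists_stdNormalCDF_eq {p : ℝ} (hp0 : 0 < p) (hp1 : p < 1) :
    ∃ z, stdNormalCDF z = p := by
  have h : stdNormalCDF = ProbabilityTheory.cdf (ProbabilityTheory.gaussianReal 0 1) :=
    funext stdNormalCDF_eq_cdf
  refine mem_range_of_exists_le_of_exists_ge continuous_stdNormalCDF ?_ ?_
  · rw [h]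
    exact (((ProbabilityTheory.tendsto_cdf_atBot _).eventually_lt_const hp0).exists).imp
      fun _ => le_of_lt
  · rw [h]
    exact (((ProbabilityTheory.tendsto_cdf_atTop _).eventually_const_lt hp1).exists).imp
      fun _ => le_of_lt

/-- The public belief at which the marginal citizen's distance from the public belief is `d`. -/
noncomputable def beliefOfGap (b c k₁ σ d : ℝ) : ℝ :=
  (k₁ * stdNormalCDF (d / σ) - c - k₁) / b - d

theorem beliefOfGap_strictAnti {b k₁ σ : ℝ} (c : ℝ) (hb : 0 < b) (hk : 0 < k₁) (hσ : 0 < σ)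
    (hslope : k₁ < b * σ * Real.sqrt (2 * Real.pi)) : StrictAnti (beliefOfGap b c k₁ σ) := by
  intro s t hst
  have hst' : 0 < t - s := sub_pos.2 hst
  have hq : 0 < Real.sqrt (2 * Real.pi) := by positivity
  have h1 := stdNormalCDF_sub_le (div_le_div_of_nonneg_right hst.le hσ.le)
  have h2 : k₁ * ((Real.sqrt (2 * Real.pi))⁻¹ * (t / σ - s / σ)) < b * (t - s) := by
    have : k₁ * ((Real.sqrt (2 * Real.pi))⁻¹ * (t / σ - s / σ)) =
        k₁ / (σ * Real.sqrt (2 * Real.pi)) * (t - s) := by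
      field_simp
    rw [this]
    refine mul_lt_mul_of_pos_right ?_ hst'
    rw [div_lt_iff₀ (by positivity), ← mul_assoc]
    exact hslope
  have h3 := mul_le_mul_of_nonneg_left h1 hk.le
  have h4 : beliefOfGap b c k₁ σ s - beliefOfGap b c k₁ σ t =
      (b * (t - s) - k₁ * (stdNormalCDF (t / σ) - stdNormalCDF (s / σ))) / b := by
    unfold beliefOfGap
    field_simp
    ring
  rw [← sub_pos, h4]
  exact div_pos (by linarith) hb

/-- Proposition 5 (monitoring reports): with interim mean belief
`μ̄(m) = (τ₀μ₀ + (τ_e + τ_m)(e − x) − τ_m(m − x))/(τ₀ + τ_e + τ_m)` and, in the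
unique-equilibrium case `b·σ·√(2π) > k₁`, equilibrium threshold `θ̂ = f`, the
expected protest level `Φ(κ·(θ̂(μ̄(m)) − μ̄(m)))` is strictly increasing in the
monitoring report `m`, and for any yield payoff `y ∈ (0, 1)` there is a unique
critical report `m*` such that the incumbent steps down (expected protest
exceeds `1 − y`) iff `m > m*`. -/
theorem stmt18 (τ0 τe τm : ℝ) (h0 : 0 < τ0) (he : 0 < τe) (hm : 0 < τm)
    (μ0 x e : ℝ)
    (b c k₁ σ : ℝ) (hb : 0 < b) (hc : 0 < c) (hk : 0 < k₁) (hσ : 0 < σ)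
    (hslope : b * σ * Real.sqrt (2 * Real.pi) > k₁)
    (f : ℝ → ℝ)
    (hf : ∀ μ : ℝ, b * f μ + c + k₁ = k₁ * stdNormalCDF ((f μ - μ) / σ))
    (κ : ℝ) (hκ : 0 < κ)
    (μbar : ℝ → ℝ)
    (hμbar : ∀ m : ℝ, μbar m =
      (τ0 * μ0 + (τe + τm) * (e - x) - τm * (m - x)) / (τ0 + τe + τm)) :
    StrictMono (fun m : ℝ => stdNormalCDF (κ * (f (μbar m) - μbar m))) ∧
    ∀ y : ℝ, 0 < y → y < 1 →
      ∃! ms : ℝ, ∀ m : ℝ,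
        stdNormalCDF (κ * (f (μbar m) - μbar m)) > 1 - y ↔ m > ms := by
  have hanti := beliefOfGap_strictAnti c hb hk hσ hslope
  have hinv : ∀ μ, beliefOfGap b c k₁ σ (f μ - μ) = μ := by
    intro μ
    rw [beliefOfGap, ← hf μ]
    field_simp
    ring
  have hgap : StrictAnti fun μ => f μ - μ := by
    intro μ₁ μ₂ h
    rw [← hinv μ₁, ← hinv μ₂] at h
    exact hanti.lt_iff_gt.1 h
  have hT : 0 < τ0 + τe + τm := by positivity
  have hbar : StrictAnti μbar := by
    intro m₁ m₂ h
    rw [hμbar, hμbar]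
    refine div_lt_div_of_pos_right ?_ hT
    nlinarith
  have hmono : StrictMono fun m : ℝ => stdNormalCDF (κ * (f (μbar m) - μbar m)) := by
    intro m₁ m₂ h
    exact stdNormalCDF_strictMono (mul_lt_mul_of_pos_left (hgap (hbar h)) hκ)
  refine ⟨hmono, fun y hy0 hy1 => ?_⟩
  obtain ⟨z, hz⟩ := exists_stdNormalCDF_eq (p := 1 - y) (by linarith) (by linarith)
  obtain ⟨ms, hms⟩ : ∃ ms, μbar ms = beliefOfGap b c k₁ σ (z / κ) := by
    refine ⟨x + (τ0 * μ0 + (τe + τm) * (e - x) -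
      beliefOfGap b c k₁ σ (z / κ) * (τ0 + τe + τm)) / τm, ?_⟩
    rw [hμbar]
    field_simp
    ring
  have hprotest : stdNormalCDF (κ * (f (μbar ms) - μbar ms)) = 1 - y := by
    have hd : f (μbar ms) - μbar ms = z / κ := hanti.injective ((hinv _).trans hms)
    rw [hd, mul_div_cancel₀ z hκ.ne', hz]
  have hiff : ∀ m, stdNormalCDF (κ * (f (μbar m) - μbar m)) > 1 - y ↔ m > ms := by
    intro m
    rw [← hprotest]
    exact hmono.lt_iff_lt
  refine ⟨ms, hiff, fun ms' h' => ?_⟩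
  have h : ∀ m, m > ms' ↔ m > ms := fun m => (h' m).symm.trans (hiff m)
  exact le_antisymm (not_lt.1 fun hlt => lt_irrefl _ ((h ms').2 hlt))
    (not_lt.1 fun hlt => lt_irrefl _ ((h ms).1 hlt))
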